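/- Under the hypotheses of the continuous MHD energy identity (smooth, spatially compactly supported fields u, p, E, B, forcing f on [0,T] × ℝ³ solving ∂ₜu + (∇u)u − Re⁻¹Δu − j×B + ∇p = f, j = Rm⁻¹ curl B with j := E + u×B, ∂ₜB + curl E = 0, div B = 0, div u = 0, for Re, Rm > 0), assume in addition that a Poincaré inequality holds: there is C_P > 0 such that ∫_{ℝ³}|u(t,·)|² dx ≤ C_P² ∫_{ℝ³}|∇u(t,·)|² dx for all t ∈ [0,T]. Then for every t ∈ [0,T]: ∫|u(t,·)|² + Rm⁻¹∫|B(t,·)|² + Re⁻¹ ∫₀ᵗ∫|∇u(s,·)|² dx ds + 2∫₀ᵗ∫|j(s,·)|² dx ds ≤ ∫|u(0,·)|² + Rm⁻¹∫|B(0,·)|² + C_P² Re ∫₀ᵗ∫|f(s,·)|² dx ds. -/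

import Mathlib

open MeasureTheory

/-- Partial derivative in the `i`-th coordinate direction of a scalar field on `ℝ³`. -/
noncomputable def pd (f : EuclideanSpace ℝ (Fin 3) → ℝ) (i : Fin 3)
    (x : EuclideanSpace ℝ (Fin 3)) : ℝ :=
  fderiv ℝ f x (EuclideanSpace.single i 1)

/-- Divergence of a vector field on `ℝ³`. -/
noncomputable def vdiv (F : EuclideanSpace ℝ (Fin 3) → Fin 3 → ℝ)
    (x : EuclideanSpace ℝ (Fin 3)) : ℝ :=
  ∑ i, pd (fun y => F y i) i x

/-- Curl of a vector field on `ℝ³`. -/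
noncomputable def vcurl (F : EuclideanSpace ℝ (Fin 3) → Fin 3 → ℝ)
    (x : EuclideanSpace ℝ (Fin 3)) : Fin 3 → ℝ :=
  ![pd (fun y => F y 2) 1 x - pd (fun y => F y 1) 2 x,
    pd (fun y => F y 0) 2 x - pd (fun y => F y 2) 0 x,
    pd (fun y => F y 1) 0 x - pd (fun y => F y 0) 1 x]

/-- Cross product in `ℝ³`. -/
noncomputable def cross3 (a b : Fin 3 → ℝ) : Fin 3 → ℝ :=
  ![a 1 * b 2 - a 2 * b 1, a 2 * b 0 - a 0 * b 2, a 0 * b 1 - a 1 * b 0]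

section PartialDerivatives

variable {f g : EuclideanSpace ℝ (Fin 3) → ℝ} {k : Fin 3} {x : EuclideanSpace ℝ (Fin 3)}

lemma pd_add (hf : DifferentiableAt ℝ f x) (hg : DifferentiableAt ℝ g x) :
    pd (fun y => f y + g y) k x = pd f k x + pd g k x := by
  simp [pd, fderiv_fun_add hf hg]

lemma pd_sub (hf : DifferentiableAt ℝ f x) (hg : DifferentiableAt ℝ g x) :
    pd (fun y => f y - g y) k x = pd f k x - pd g k x := by
  simp [pd, fderiv_fun_sub hf hg]

lemma pd_mul (hf : DifferentiableAt ℝ f x) (hg : DifferentiableAt ℝ g x) :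
    pd (fun y => f y * g y) k x = pd f k x * g x + f x * pd g k x := by
  simp [pd, fderiv_fun_mul hf hg]
  ring

lemma pd_const_mul (c : ℝ) (hf : DifferentiableAt ℝ f x) :
    pd (fun y => c * f y) k x = c * pd f k x := by
  simp [pd, fderiv_const_mul hf]

lemma pd_sum {F : EuclideanSpace ℝ (Fin 3) → Fin 3 → ℝ}
    (hF : ∀ i, DifferentiableAt ℝ (fun y => F y i) x) :
    pd (fun y => ∑ i, F y i) k x = ∑ i, pd (fun y => F y i) k x := by
  simp [pd, fderiv_fun_sum fun i _ => hF i]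

lemma ContDiff.pd {n m : WithTop ℕ∞} (hf : ContDiff ℝ n f) (hm : m + 1 ≤ n) (k : Fin 3) :
    ContDiff ℝ m (pd f k) :=
  (hf.fderiv_right hm).clm_apply contDiff_const

lemma pd_eq_zero_of_norm_gt {R : ℝ} (hf : ∀ y, R < ‖y‖ → f y = 0) (hx : R < ‖x‖) :
    pd f k x = 0 := by
  have h : f =ᶠ[nhds x] fun _ => 0 := by
    filter_upwards [(isOpen_lt continuous_const continuous_norm).mem_nhds hx] with y hy
    exact hf y hy
  simp [pd, h.fderiv_eq]

lemma hasCompactSupport_of_norm_gt {R : ℝ} (hf : ∀ y, R < ‖y‖ → f y = 0) :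
    HasCompactSupport f :=
  HasCompactSupport.intro (isCompact_closedBall 0 R) fun y hy => hf y (by simpa using hy)

lemma integral_pd_eq_zero (hf : ContDiff ℝ 1 f) (hc : HasCompactSupport f) (k : Fin 3) :
    ∫ x, pd f k x = 0 := by
  have hi : Integrable (fun x => fderiv ℝ f x (EuclideanSpace.single k 1)) :=
    (hf.pd (m := 0) (by simp) k).continuous.integrable_of_hasCompactSupport
      (hc.fderiv_apply ℝ _)
  have h := integral_mul_fderiv_eq_neg_fderiv_mul_of_integrable (μ := volume)
    (f := fun _ : EuclideanSpace ℝ (Fin 3) => (1 : ℝ)) (g := f)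
    (v := EuclideanSpace.single k 1) (by simp) (by simpa using hi)
    (by simpa using hf.continuous.integrable_of_hasCompactSupport hc)
    (fun _ _ => by fun_prop) (fun x _ => hf.differentiable (by simp) x)
  simpa [pd] using h

end PartialDerivatives

section EnergyFlux

/-- The spatial flux in the local energy balance of the resistive MHD system. -/
noncomputable def mhdFlux (Re Rm : ℝ) (u E B : EuclideanSpace ℝ (Fin 3) → Fin 3 → ℝ)
    (p : EuclideanSpace ℝ (Fin 3) → ℝ) (k : Fin 3) (y : EuclideanSpace ℝ (Fin 3)) : ℝ :=
  Re⁻¹ * (∑ i, u y i * pd (fun z => u z i) k y)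
    - (p y + 2⁻¹ * ∑ i, u y i * u y i) * u y k
    - Rm⁻¹ * cross3 (E y) (B y) k

variable {Re Rm : ℝ} {u E B : EuclideanSpace ℝ (Fin 3) → Fin 3 → ℝ}
  {p : EuclideanSpace ℝ (Fin 3) → ℝ}

lemma pd_cross3 (hE : ContDiff ℝ 2 E) (hB : ContDiff ℝ 2 B) (k i : Fin 3)
    (x : EuclideanSpace ℝ (Fin 3)) :
    pd (fun y => cross3 (E y) (B y) i) k x
      = cross3 (fun l => pd (fun y => E y l) k x) (B x) i
        + cross3 (E x) (fun l => pd (fun y => B y l) k x) i := by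
  have hE' : ∀ l, DifferentiableAt ℝ (fun y => E y l) x := fun l =>
    (contDiff_pi.1 hE l).differentiable (by simp) x
  have hB' : ∀ l, DifferentiableAt ℝ (fun y => B y l) x := fun l =>
    (contDiff_pi.1 hB l).differentiable (by simp) x
  have key : ∀ a b c d : Fin 3, pd (fun y => E y a * B y b - E y c * B y d) k x
      = pd (fun y => E y a) k x * B x b + E x a * pd (fun y => B y b) k x
        - (pd (fun y => E y c) k x * B x d + E x c * pd (fun y => B y d) k x) := by
    intro a b c d
    rw [pd_sub ((hE' a).fun_mul (hB' b)) ((hE' c).fun_mul (hB' d)), pd_mul (hE' a) (hB' b),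
      pd_mul (hE' c) (hB' d)]
  fin_cases i <;> simp [cross3, key] <;> ring

lemma contDiff_cross3 {n : WithTop ℕ∞} (hE : ContDiff ℝ n E) (hB : ContDiff ℝ n B) (i : Fin 3) :
    ContDiff ℝ n (fun y => cross3 (E y) (B y) i) := by
  have hE' := contDiff_pi.1 hE
  have hB' := contDiff_pi.1 hB
  fin_cases i <;> simp [cross3] <;> fun_prop

lemma contDiff_mhdFlux (hu : ContDiff ℝ 2 u) (hE : ContDiff ℝ 2 E) (hB : ContDiff ℝ 2 B)
    (hp : ContDiff ℝ 2 p) (k : Fin 3) : ContDiff ℝ 1 (mhdFlux Re Rm u E B p k) := by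
  have hu' : ∀ i, ContDiff ℝ 1 (fun y => u y i) := fun i =>
    (contDiff_pi.1 hu i).of_le (by norm_num)
  have hdu : ∀ i, ContDiff ℝ 1 (pd (fun z => u z i) k) := fun i =>
    (contDiff_pi.1 hu i).pd (by norm_num) k
  have hp' : ContDiff ℝ 1 p := hp.of_le (by norm_num)
  have hc : ContDiff ℝ 1 (fun y => cross3 (E y) (B y) k) :=
    (contDiff_cross3 hE hB k).of_le (by norm_num)
  unfold mhdFlux
  fun_prop

lemma pd_mhdFlux (hu : ContDiff ℝ 2 u) (hE : ContDiff ℝ 2 E) (hB : ContDiff ℝ 2 B)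
    (hp : ContDiff ℝ 2 p) (k : Fin 3) (x : EuclideanSpace ℝ (Fin 3)) :
    pd (mhdFlux Re Rm u E B p k) k x
      = Re⁻¹ * (∑ i, (pd (fun z => u z i) k x * pd (fun z => u z i) k x
            + u x i * pd (fun y => pd (fun z => u z i) k y) k x))
        - ((pd p k x + 2⁻¹ * ∑ i, (pd (fun z => u z i) k x * u x i
              + u x i * pd (fun z => u z i) k x)) * u x k
          + (p x + 2⁻¹ * ∑ i, u x i * u x i) * pd (fun z => u z k) k x)
        - Rm⁻¹ * (cross3 (fun l => pd (fun y => E y l) k x) (B x) k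
          + cross3 (E x) (fun l => pd (fun y => B y l) k x) k) := by
  have hu' : ∀ i, DifferentiableAt ℝ (fun y => u y i) x := fun i =>
    (contDiff_pi.1 hu i).differentiable (by simp) x
  have hdu : ∀ i, DifferentiableAt ℝ (fun y => pd (fun z => u z i) k y) x := fun i =>
    ((contDiff_pi.1 hu i).pd (m := 1) (by norm_num) k).differentiable (by simp) x
  have hp' : DifferentiableAt ℝ p x := hp.differentiable (by simp) x
  have hc : DifferentiableAt ℝ (fun y => cross3 (E y) (B y) k) x :=
    (contDiff_cross3 hE hB k).differentiable (by simp) x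
  unfold mhdFlux
  rw [pd_sub (by fun_prop) (by fun_prop), pd_sub (by fun_prop) (by fun_prop),
    pd_const_mul _ (by fun_prop), pd_sum (fun i => by fun_prop), pd_mul (by fun_prop) (by fun_prop),
    pd_add (by fun_prop) (by fun_prop), pd_const_mul _ (by fun_prop), pd_sum (fun i => by fun_prop),
    pd_const_mul _ hc, pd_cross3 hE hB]
  simp_rw [fun i => pd_mul (k := k) (hu' i) (hdu i), fun i => pd_mul (k := k) (hu' i) (hu' i)]

/-- Local energy balance of the resistive MHD system at a fixed time. -/
lemma mhd_local_energy_balance (hu : ContDiff ℝ 2 u) (hE : ContDiff ℝ 2 E) (hB : ContDiff ℝ 2 B)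
    (hp : ContDiff ℝ 2 p) (x : EuclideanSpace ℝ (Fin 3)) (ut Bt f : Fin 3 → ℝ)
    (hmom : ∀ i : Fin 3,
      ut i + (∑ k, pd (fun y => u y i) k x * u x k)
        - Re⁻¹ * (∑ k, pd (fun y => pd (fun z => u z i) k y) k x)
        - cross3 (E x + cross3 (u x) (B x)) (B x) i + pd p i x = f i)
    (hohm : ∀ i : Fin 3, E x i + cross3 (u x) (B x) i = Rm⁻¹ * vcurl B x i)
    (hfar : ∀ i : Fin 3, Bt i + vcurl E x i = 0)
    (hdivu : vdiv u x = 0) :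
    ∑ i, u x i * ut i + Rm⁻¹ * ∑ i, B x i * Bt i
        + Re⁻¹ * (∑ i, ∑ k, (pd (fun y => u y i) k x) ^ 2)
        + ∑ i, (E x i + cross3 (u x) (B x) i) ^ 2
      = ∑ i, f i * u x i + ∑ k, pd (mhdFlux Re Rm u E B p k) k x := by
  simp_rw [pd_mhdFlux hu hE hB hp]
  have m0 := hmom 0
  have m1 := hmom 1
  have m2 := hmom 2
  have o0 := hohm 0
  have o1 := hohm 1
  have o2 := hohm 2
  have f0 := hfar 0
  have f1 := hfar 1
  have f2 := hfar 2
  simp only [vdiv, vcurl, cross3, Fin.sum_univ_three, Pi.add_apply, Matrix.cons_val] at *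
  linear_combination u x 0 * m0 + u x 1 * m1 + u x 2 * m2
    + Rm⁻¹ * (B x 0 * f0 + B x 1 * f1 + B x 2 * f2)
    + E x 0 * o0 + E x 1 * o1 + E x 2 * o2
    + (p x + 2⁻¹ * (u x 0 * u x 0 + u x 1 * u x 1 + u x 2 * u x 2)) * hdivu

end EnergyFlux

section TimeSlices

variable {g : ℝ × EuclideanSpace ℝ (Fin 3) → ℝ} {T R : ℝ}

lemma hasDerivAt_time_slice (hg : ContDiff ℝ 1 g) (t : ℝ) (x : EuclideanSpace ℝ (Fin 3)) :
    HasDerivAt (fun s => g (s, x)) (fderiv ℝ g (t, x) (1, 0)) t :=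
  (hg.differentiable (by simp) (t, x)).hasFDerivAt.comp_hasDerivAt t
    ((hasDerivAt_id t).prodMk (hasDerivAt_const t x))

lemma pd_space_slice (hg : ContDiff ℝ 1 g) (t : ℝ) (x : EuclideanSpace ℝ (Fin 3)) (k : Fin 3) :
    pd (fun y => g (t, y)) k x = fderiv ℝ g (t, x) (0, EuclideanSpace.single k 1) := by
  have h : HasFDerivAt (fun y => g (t, y)) _ x :=
    (hg.differentiable (by simp) (t, x)).hasFDerivAt.comp x
      ((hasFDerivAt_const t x).prodMk (hasFDerivAt_id x))
  simp [pd, h.fderiv]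

lemma continuous_deriv_time_slice (hg : ContDiff ℝ 1 g) :
    Continuous fun q : ℝ × EuclideanSpace ℝ (Fin 3) => deriv (fun s => g (s, q.2)) q.1 := by
  simp_rw [fun q : ℝ × EuclideanSpace ℝ (Fin 3) => (hasDerivAt_time_slice hg q.1 q.2).deriv]
  exact (hg.continuous_fderiv (by simp)).clm_apply continuous_const

lemma continuous_pd_space_slice (hg : ContDiff ℝ 1 g) (k : Fin 3) :
    Continuous fun q : ℝ × EuclideanSpace ℝ (Fin 3) => pd (fun y => g (q.1, y)) k q.2 := by
  simp_rw [pd_space_slice hg]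
  exact (hg.continuous_fderiv (by simp)).clm_apply continuous_const

lemma deriv_eq_zero_of_eqOn_Icc {h : ℝ → ℝ} (hT : 0 < T) {t : ℝ} (ht : t ∈ Set.Icc 0 T)
    (hd : DifferentiableAt ℝ h t) (h0 : ∀ s ∈ Set.Icc 0 T, h s = 0) : deriv h t = 0 := by
  have hu : UniqueDiffWithinAt ℝ (Set.Icc 0 T) t := uniqueDiffOn_Icc hT t ht
  rw [← hd.derivWithin hu, derivWithin_congr (f := fun _ => (0 : ℝ)) h0 (h0 t ht)]
  simp

lemma integral_eq_setIntegral_closedBall {h : EuclideanSpace ℝ (Fin 3) → ℝ}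
    (h0 : ∀ x, R < ‖x‖ → h x = 0) :
    ∫ x, h x = ∫ x in Metric.closedBall 0 R, h x :=
  (setIntegral_eq_integral_of_forall_compl_eq_zero fun x hx => h0 x (by simpa using hx)).symm

lemma continuousOn_integral_space_slice (hg : Continuous g)
    (h0 : ∀ t ∈ Set.Icc 0 T, ∀ x, R < ‖x‖ → g (t, x) = 0) :
    ContinuousOn (fun t => ∫ x, g (t, x)) (Set.Icc 0 T) := by
  have hc : Continuous fun t => ∫ x in Metric.closedBall 0 R, g (t, x) :=
    continuous_parametric_integral_of_continuous (f := fun t x => g (t, x)) hg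
      (isCompact_closedBall 0 R)
  exact hc.continuousOn.congr fun t ht => integral_eq_setIntegral_closedBall (h0 t ht)

lemma intervalIntegrable_integral_space_slice (hg : Continuous g)
    (h0 : ∀ t ∈ Set.Icc 0 T, ∀ x, R < ‖x‖ → g (t, x) = 0) {t : ℝ} (ht : t ∈ Set.Icc 0 T) :
    IntervalIntegrable (fun s => ∫ x, g (s, x)) volume 0 t := by
  refine ((continuousOn_integral_space_slice hg h0).mono ?_).intervalIntegrable
  rw [Set.uIcc_of_le ht.1]
  exact Set.Icc_subset_Icc_right ht.2

lemma integrable_space_slice (hg : Continuous g)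
    (h0 : ∀ t ∈ Set.Icc 0 T, ∀ x, R < ‖x‖ → g (t, x) = 0) {t : ℝ} (ht : t ∈ Set.Icc 0 T) :
    Integrable fun x => g (t, x) :=
  (hg.comp (Continuous.prodMk_right t)).integrable_of_hasCompactSupport
    (hasCompactSupport_of_norm_gt (h0 t ht))

lemma integral_sub_integral_eq_intervalIntegral_deriv (hT : 0 < T) (hg : ContDiff ℝ 1 g)
    (h0 : ∀ t ∈ Set.Icc 0 T, ∀ x, R < ‖x‖ → g (t, x) = 0) {t : ℝ} (ht : t ∈ Set.Icc 0 T) :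
    (∫ x, g (t, x)) - ∫ x, g (0, x)
      = ∫ s in (0 : ℝ)..t, ∫ x, deriv (fun r => g (r, x)) s := by
  have hdc := continuous_deriv_time_slice hg
  have hd0 : ∀ s ∈ Set.Icc 0 T, ∀ x, R < ‖x‖ → deriv (fun r => g (r, x)) s = 0 :=
    fun s hs x hx => deriv_eq_zero_of_eqOn_Icc hT hs
      (hasDerivAt_time_slice hg s x).differentiableAt fun r hr => h0 r hr x hx
  have hint : Integrable
      (Function.uncurry fun (s : ℝ) (x : EuclideanSpace ℝ (Fin 3)) => deriv (fun r => g (r, x)) s)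
      ((volume.restrict (Set.uIoc 0 t)).prod (volume.restrict (Metric.closedBall 0 R))) := by
    rw [Measure.prod_restrict, ← Measure.volume_eq_prod, ← IntegrableOn]
    refine IntegrableOn.mono_set (hdc.continuousOn.integrableOn_compact
      ((isCompact_uIcc (a := 0) (b := t)).prod (isCompact_closedBall (0 : EuclideanSpace ℝ (Fin 3)) R))) ?_
    exact Set.prod_mono Set.uIoc_subset_uIcc le_rfl
  calc (∫ x, g (t, x)) - ∫ x, g (0, x)
      = ∫ x, (g (t, x) - g (0, x)) :=
        (integral_sub (integrable_space_slice hg.continuous h0 ht)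
          (integrable_space_slice hg.continuous h0 ⟨le_rfl, hT.le⟩)).symm
    _ = ∫ x in Metric.closedBall 0 R, (g (t, x) - g (0, x)) :=
        integral_eq_setIntegral_closedBall fun x hx => by
          rw [h0 t ht x hx, h0 0 ⟨le_rfl, hT.le⟩ x hx, sub_zero]
    _ = ∫ x in Metric.closedBall 0 R, ∫ s in (0 : ℝ)..t, deriv (fun r => g (r, x)) s := by
        congr 1 with x
        exact (intervalIntegral.integral_deriv_eq_sub
          (fun s _ => (hasDerivAt_time_slice hg s x).differentiableAt)
          ((hdc.comp (Continuous.prodMk_left x)).intervalIntegrable _ _)).symm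
    _ = ∫ s in (0 : ℝ)..t, ∫ x in Metric.closedBall 0 R, deriv (fun r => g (r, x)) s :=
        (intervalIntegral_integral_swap hint).symm
    _ = ∫ s in (0 : ℝ)..t, ∫ x, deriv (fun r => g (r, x)) s := by
        refine intervalIntegral.integral_congr fun s hs => ?_
        rw [Set.uIcc_of_le ht.1] at hs
        exact (integral_eq_setIntegral_closedBall (hd0 s ⟨hs.1, hs.2.trans ht.2⟩)).symm

end TimeSlices

/-- integrated stability estimate for smooth, spatially compactly supported
solutions of the resistive MHD equations, under a Poincaré inequality with constant `C_P`:
for every `t ∈ [0,T]`,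
`‖u(t)‖² + Rm⁻¹‖B(t)‖² + Re⁻¹∫₀ᵗ‖∇u‖² + 2∫₀ᵗ‖j‖² ≤ ‖u(0)‖² + Rm⁻¹‖B(0)‖² + C_P²Re∫₀ᵗ‖f‖²`. -/
theorem mhd_integrated_stability
    (Re Rm T CP : ℝ) (hRe : 0 < Re) (hRm : 0 < Rm) (hT : 0 < T) (hCP : 0 < CP)
    (u E B : ℝ × EuclideanSpace ℝ (Fin 3) → Fin 3 → ℝ)
    (p : ℝ × EuclideanSpace ℝ (Fin 3) → ℝ)
    (f : ℝ × EuclideanSpace ℝ (Fin 3) → Fin 3 → ℝ)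
    (hu : ContDiff ℝ 2 u) (hE : ContDiff ℝ 2 E) (hB : ContDiff ℝ 2 B)
    (hp : ContDiff ℝ 2 p) (hf : ContDiff ℝ 2 f)
    -- supports contained in a fixed ball, uniformly in time
    (hsupp : ∃ R : ℝ, 0 < R ∧ ∀ t ∈ Set.Icc (0 : ℝ) T, ∀ x : EuclideanSpace ℝ (Fin 3),
      R ≤ ‖x‖ → u (t, x) = 0 ∧ E (t, x) = 0 ∧ B (t, x) = 0 ∧ p (t, x) = 0)
    -- momentum equation: ∂ₜu + (∇u)u − Re⁻¹Δu − j×B + ∇p = f, with j := E + u×B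
    (hmom : ∀ t ∈ Set.Icc (0 : ℝ) T, ∀ x : EuclideanSpace ℝ (Fin 3), ∀ i : Fin 3,
      deriv (fun s => u (s, x) i) t
        + (∑ k, pd (fun y => u (t, y) i) k x * u (t, x) k)
        - Re⁻¹ * (∑ k, pd (fun y => pd (fun z => u (t, z) i) k y) k x)
        - cross3 (E (t, x) + cross3 (u (t, x)) (B (t, x))) (B (t, x)) i
        + pd (fun y => p (t, y)) i x
      = f (t, x) i)
    -- Ohm's law: j = Rm⁻¹ curl B
    (hohm : ∀ t ∈ Set.Icc (0 : ℝ) T, ∀ x : EuclideanSpace ℝ (Fin 3), ∀ i : Fin 3,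
      E (t, x) i + cross3 (u (t, x)) (B (t, x)) i
        = Rm⁻¹ * vcurl (fun y => B (t, y)) x i)
    -- Faraday's law: ∂ₜB + curl E = 0
    (hfar : ∀ t ∈ Set.Icc (0 : ℝ) T, ∀ x : EuclideanSpace ℝ (Fin 3), ∀ i : Fin 3,
      deriv (fun s => B (s, x) i) t + vcurl (fun y => E (t, y)) x i = 0)
    -- solenoidal constraints
    (hdivB : ∀ t ∈ Set.Icc (0 : ℝ) T, ∀ x : EuclideanSpace ℝ (Fin 3),
      vdiv (fun y => B (t, y)) x = 0)
    (hdivu : ∀ t ∈ Set.Icc (0 : ℝ) T, ∀ x : EuclideanSpace ℝ (Fin 3),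
      vdiv (fun y => u (t, y)) x = 0)
    -- Poincaré inequality
    (hpoincare : ∀ t ∈ Set.Icc (0 : ℝ) T,
      (∫ x : EuclideanSpace ℝ (Fin 3), ∑ i, (u (t, x) i) ^ 2)
        ≤ CP ^ 2 * ∫ x : EuclideanSpace ℝ (Fin 3),
            ∑ i, ∑ k, (pd (fun y => u (t, y) i) k x) ^ 2) :
    ∀ t ∈ Set.Icc (0 : ℝ) T,
      (∫ x : EuclideanSpace ℝ (Fin 3), ∑ i, (u (t, x) i) ^ 2)
        + Rm⁻¹ * (∫ x : EuclideanSpace ℝ (Fin 3), ∑ i, (B (t, x) i) ^ 2)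
        + Re⁻¹ * (∫ s in (0 : ℝ)..t, ∫ x : EuclideanSpace ℝ (Fin 3),
            ∑ i, ∑ k, (pd (fun y => u (s, y) i) k x) ^ 2)
        + 2 * (∫ s in (0 : ℝ)..t, ∫ x : EuclideanSpace ℝ (Fin 3),
            ∑ i, (E (s, x) i + cross3 (u (s, x)) (B (s, x)) i) ^ 2)
      ≤ (∫ x : EuclideanSpace ℝ (Fin 3), ∑ i, (u (0, x) i) ^ 2)
        + Rm⁻¹ * (∫ x : EuclideanSpace ℝ (Fin 3), ∑ i, (B (0, x) i) ^ 2)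
        + CP ^ 2 * Re * ∫ s in (0 : ℝ)..t, ∫ x : EuclideanSpace ℝ (Fin 3),
            ∑ i, (f (s, x) i) ^ 2 := by
  obtain ⟨R, -, hR⟩ := hsupp
  have hu1 : ∀ i, ContDiff ℝ 1 fun q => u q i := fun i =>
    (contDiff_pi.1 hu i).of_le (by norm_num)
  have hB1 : ∀ i, ContDiff ℝ 1 fun q => B q i := fun i =>
    (contDiff_pi.1 hB i).of_le (by norm_num)
  have hu0 : ∀ t ∈ Set.Icc 0 T, ∀ x, R < ‖x‖ → u (t, x) = 0 := fun t ht x hx =>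
    (hR t ht x hx.le).1
  have hE0 : ∀ t ∈ Set.Icc 0 T, ∀ x, R < ‖x‖ → E (t, x) = 0 := fun t ht x hx =>
    (hR t ht x hx.le).2.1
  have hB0 : ∀ t ∈ Set.Icc 0 T, ∀ x, R < ‖x‖ → B (t, x) = 0 := fun t ht x hx =>
    (hR t ht x hx.le).2.2.1
  have hp0 : ∀ t ∈ Set.Icc 0 T, ∀ x, R < ‖x‖ → p (t, x) = 0 := fun t ht x hx =>
    (hR t ht x hx.le).2.2.2
  have hdu0 : ∀ t ∈ Set.Icc 0 T, ∀ x, R < ‖x‖ → ∀ i k, pd (fun y => u (t, y) i) k x = 0 :=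
    fun t ht x hx i k => pd_eq_zero_of_norm_gt (fun y hy => by simp [hu0 t ht y hy]) hx
  have hf0 : ∀ t ∈ Set.Icc 0 T, ∀ x, R < ‖x‖ → ∀ i, f (t, x) i = 0 := by
    intro t ht x hx i
    have hut : deriv (fun s => u (s, x) i) t = 0 :=
      deriv_eq_zero_of_eqOn_Icc hT ht (hasDerivAt_time_slice (hu1 i) t x).differentiableAt
        fun s hs => by simp [hu0 s hs x hx]
    have hddu : ∀ k, pd (fun y => pd (fun z => u (t, z) i) k y) k x = 0 := fun k =>
      pd_eq_zero_of_norm_gt (fun y hy => hdu0 t ht y hy i k) hx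
    have hdp : pd (fun y => p (t, y)) i x = 0 := pd_eq_zero_of_norm_gt (hp0 t ht) hx
    rw [← hmom t ht x i, hut, hdp]
    simp only [hdu0 t ht x hx, hddu, hu0 t ht x hx, hE0 t ht x hx, hB0 t ht x hx]
    fin_cases i <;> simp [cross3]
  -- the space-time densities are continuous and spatially supported in a fixed ball
  have hUc : Continuous fun q => ∑ i, (u q i) ^ 2 := by have := hu.continuous; fun_prop
  have hFc : Continuous fun q => ∑ i, (f q i) ^ 2 := by have := hf.continuous; fun_prop
  have hDc : Continuous fun q : ℝ × EuclideanSpace ℝ (Fin 3) =>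
      ∑ i, ∑ k, (pd (fun y => u (q.1, y) i) k q.2) ^ 2 :=
    continuous_finsetSum _ fun i _ => continuous_finsetSum _ fun k _ =>
      (continuous_pd_space_slice (hu1 i) k).pow 2
  have hJc : Continuous fun q => ∑ i, (E q i + cross3 (u q) (B q) i) ^ 2 := by
    have := hu.continuous
    have := hE.continuous
    have := hB.continuous
    simp only [cross3, Fin.sum_univ_three, Matrix.cons_val]
    fun_prop
  have hG1 : ContDiff ℝ 1 fun q => ∑ i, (u q i) ^ 2 + Rm⁻¹ * ∑ i, (B q i) ^ 2 := by fun_prop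
  have hGc := continuous_deriv_time_slice hG1
  have hU0 : ∀ t ∈ Set.Icc 0 T, ∀ x, R < ‖x‖ → ∑ i, (u (t, x) i) ^ 2 = 0 :=
    fun t ht x hx => by simp [hu0 t ht x hx]
  have hF0 : ∀ t ∈ Set.Icc 0 T, ∀ x, R < ‖x‖ → ∑ i, (f (t, x) i) ^ 2 = 0 :=
    fun t ht x hx => by simp [hf0 t ht x hx]
  have hD0 : ∀ t ∈ Set.Icc 0 T, ∀ x, R < ‖x‖ →
      ∑ i, ∑ k, (pd (fun y => u (t, y) i) k x) ^ 2 = 0 :=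
    fun t ht x hx => by simp [hdu0 t ht x hx]
  have hJ0 : ∀ t ∈ Set.Icc 0 T, ∀ x, R < ‖x‖ →
      ∑ i, (E (t, x) i + cross3 (u (t, x)) (B (t, x)) i) ^ 2 = 0 :=
    fun t ht x hx => by
      simp [hu0 t ht x hx, hE0 t ht x hx, hB0 t ht x hx, cross3, Fin.sum_univ_three]
  have hBs0 : ∀ t ∈ Set.Icc 0 T, ∀ x, R < ‖x‖ → ∑ i, (B (t, x) i) ^ 2 = 0 :=
    fun t ht x hx => by simp [hB0 t ht x hx]
  have hBc : Continuous fun q => ∑ i, (B q i) ^ 2 := by have := hB.continuous; fun_prop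
  have hG0 : ∀ t ∈ Set.Icc 0 T, ∀ x, R < ‖x‖ →
      ∑ i, (u (t, x) i) ^ 2 + Rm⁻¹ * ∑ i, (B (t, x) i) ^ 2 = 0 :=
    fun t ht x hx => by rw [hU0 t ht x hx, hBs0 t ht x hx, mul_zero, add_zero]
  have hGd0 : ∀ t ∈ Set.Icc 0 T, ∀ x, R < ‖x‖ →
      deriv (fun s => ∑ i, (u (s, x) i) ^ 2 + Rm⁻¹ * ∑ i, (B (s, x) i) ^ 2) t = 0 :=
    fun t ht x hx => deriv_eq_zero_of_eqOn_Icc hT ht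
      (hasDerivAt_time_slice hG1 t x).differentiableAt fun s hs => hG0 s hs x hx
  have hGd : ∀ t x, deriv (fun s => ∑ i, (u (s, x) i) ^ 2 + Rm⁻¹ * ∑ i, (B (s, x) i) ^ 2) t
      = 2 * (∑ i, u (t, x) i * deriv (fun s => u (s, x) i) t
        + Rm⁻¹ * ∑ i, B (t, x) i * deriv (fun s => B (s, x) i) t) := by
    intro t x
    have hU := HasDerivAt.fun_sum (u := Finset.univ) fun i _ =>
      ((hasDerivAt_time_slice (hu1 i) t x).differentiableAt.hasDerivAt.fun_pow 2)
    have hB := HasDerivAt.fun_sum (u := Finset.univ) fun i _ =>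
      ((hasDerivAt_time_slice (hB1 i) t x).differentiableAt.hasDerivAt.fun_pow 2)
    rw [(hU.fun_add (hB.const_mul Rm⁻¹)).deriv]
    simp only [Fin.sum_univ_three]
    push_cast
    ring
  -- differential form of the estimate
  have hineq : ∀ s ∈ Set.Icc 0 T,
      (∫ x, deriv (fun r => ∑ i, (u (r, x) i) ^ 2 + Rm⁻¹ * ∑ i, (B (r, x) i) ^ 2) s)
        + Re⁻¹ * (∫ x, ∑ i, ∑ k, (pd (fun y => u (s, y) i) k x) ^ 2)
        + 2 * (∫ x, ∑ i, (E (s, x) i + cross3 (u (s, x)) (B (s, x)) i) ^ 2)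
      ≤ CP ^ 2 * Re * ∫ x, ∑ i, (f (s, x) i) ^ 2 := by
    intro s hs
    have hus : ContDiff ℝ 2 fun y => u (s, y) := hu.comp (contDiff_prodMk_right s)
    have hEs : ContDiff ℝ 2 fun y => E (s, y) := hE.comp (contDiff_prodMk_right s)
    have hBs : ContDiff ℝ 2 fun y => B (s, y) := hB.comp (contDiff_prodMk_right s)
    have hps : ContDiff ℝ 2 fun y => p (s, y) := hp.comp (contDiff_prodMk_right s)
    set Φ := mhdFlux Re Rm (fun y => u (s, y)) (fun y => E (s, y)) (fun y => B (s, y))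
      (fun y => p (s, y)) with hΦ
    have hΦ1 : ∀ k, ContDiff ℝ 1 (Φ k) := contDiff_mhdFlux hus hEs hBs hps
    have hΦ0 : ∀ k, HasCompactSupport (Φ k) := fun k =>
      hasCompactSupport_of_norm_gt (R := R) fun y hy => by
        simp only [hΦ, mhdFlux, hu0 s hs y hy, hE0 s hs y hy, hB0 s hs y hy]
        fin_cases k <;> simp [cross3]
    have hΦi : ∀ k, Integrable (pd (Φ k) k) := fun k =>
      ((hΦ1 k).pd (m := 0) (by simp) k).continuous.integrable_of_hasCompactSupport
        ((hΦ0 k).fderiv_apply ℝ _)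
    have hUi := integrable_space_slice hUc hU0 hs
    have hFi := integrable_space_slice hFc hF0 hs
    have hDi := integrable_space_slice hDc hD0 hs
    have hJi := integrable_space_slice hJc hJ0 hs
    have hGi := integrable_space_slice hGc hGd0 hs
    have hΦs : ∫ x, ∑ k, pd (Φ k) k x = 0 := by
      rw [integral_finsetSum _ fun k _ => hΦi k]
      exact Finset.sum_eq_zero fun k _ => integral_pd_eq_zero (hΦ1 k) (hΦ0 k) k
    have hΦsi : Integrable fun x => ∑ k, pd (Φ k) k x := integrable_finsetSum _ fun k _ => hΦi k
    have hmono := integral_mono ((hGi.add (hDi.const_mul (2 * Re⁻¹))).add (hJi.const_mul 2))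
      (((hFi.const_mul (CP ^ 2 * Re)).add (hUi.const_mul (Re⁻¹ * (CP ^ 2)⁻¹))).add
        (hΦsi.const_mul 2)) (fun x => by
      have hbal := mhd_local_energy_balance hus hEs hBs hps x
        (fun i => deriv (fun r => u (r, x) i) s) (fun i => deriv (fun r => B (r, x) i) s)
        (f (s, x)) (hmom s hs x) (hohm s hs x) (hfar s hs x) (hdivu s hs x)
      have hyoung : 2 * ∑ i, f (s, x) i * u (s, x) i
          ≤ CP ^ 2 * Re * ∑ i, (f (s, x) i) ^ 2
            + Re⁻¹ * (CP ^ 2)⁻¹ * ∑ i, (u (s, x) i) ^ 2 := by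
        simp only [Finset.mul_sum, ← Finset.sum_add_distrib]
        refine Finset.sum_le_sum fun i _ => ?_
        have hc : 0 < CP ^ 2 * Re := by positivity
        have hsq : CP ^ 2 * Re * (f (s, x) i) ^ 2 + Re⁻¹ * (CP ^ 2)⁻¹ * (u (s, x) i) ^ 2
            - 2 * (f (s, x) i * u (s, x) i)
            = (CP ^ 2 * Re) * (f (s, x) i - (CP ^ 2 * Re)⁻¹ * u (s, x) i) ^ 2 := by
          field_simp
          ring
        have := mul_nonneg hc.le (sq_nonneg (f (s, x) i - (CP ^ 2 * Re)⁻¹ * u (s, x) i))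
        linarith
      simp only [Pi.add_apply, hGd]
      linarith)
    simp only [Pi.add_apply] at hmono
    rw [integral_add (by exact hGi.add (hDi.const_mul _)) (hJi.const_mul 2),
      integral_add hGi (hDi.const_mul _),
      integral_add (by exact (hFi.const_mul _).add (hUi.const_mul _)) (hΦsi.const_mul 2),
      integral_add (hFi.const_mul _) (hUi.const_mul _)] at hmono
    simp only [integral_const_mul, hΦs] at hmono
    have hpo : Re⁻¹ * (CP ^ 2)⁻¹ * (∫ x, ∑ i, (u (s, x) i) ^ 2)
        ≤ Re⁻¹ * ∫ x, ∑ i, ∑ k, (pd (fun y => u (s, y) i) k x) ^ 2 := by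
      rw [mul_assoc]
      refine mul_le_mul_of_nonneg_left ?_ (by positivity)
      rw [inv_mul_le_iff₀ (by positivity)]
      exact hpoincare s hs
    linarith
  intro t ht
  have hz : (0 : ℝ) ∈ Set.Icc 0 T := ⟨le_rfl, hT.le⟩
  have hGI := intervalIntegrable_integral_space_slice hGc hGd0 ht
  have hDI := intervalIntegrable_integral_space_slice hDc hD0 ht
  have hJI := intervalIntegrable_integral_space_slice hJc hJ0 ht
  have hFI := intervalIntegrable_integral_space_slice hFc hF0 ht
  have hint := intervalIntegral.integral_mono_on ht.1
    ((hGI.add (hDI.const_mul Re⁻¹)).add (hJI.const_mul 2)) (hFI.const_mul (CP ^ 2 * Re))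
    fun s hs => hineq s ⟨hs.1, hs.2.trans ht.2⟩
  rw [intervalIntegral.integral_add (hGI.add (hDI.const_mul _)) (hJI.const_mul _),
    intervalIntegral.integral_add hGI (hDI.const_mul _)] at hint
  simp only [intervalIntegral.integral_const_mul] at hint
  have henergy := integral_sub_integral_eq_intervalIntegral_deriv hT hG1 hG0 ht
  rw [integral_add (integrable_space_slice hUc hU0 ht)
      ((integrable_space_slice hBc hBs0 ht).const_mul _),
    integral_add (integrable_space_slice hUc hU0 hz)
      ((integrable_space_slice hBc hBs0 hz).const_mul _),
    integral_const_mul, integral_const_mul] at henergy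
  linarith
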